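/- Let R be a chain ring which is semicoherent but not coherent, with set of zero-divisors Z, and let G be a nonzero almost FP-injective R-module. Then: (a) w.d.(G) = ∞ if Z ⊊ G_♯; (b) w.d.(G) = 0 if G_♯ ∪ G^♯ ⊊ Z; (c) if G_♯ ∪ G^♯ = Z, then w.d.(G) = 0 when G is FP-injective, and w.d.(G) = ∞ when G is not FP-injective. -/

import Mathlib

open CategoryTheory

universe u

/-- A chain ring: the lattice of ideals is totally ordered by inclusion. -/
def IsChainRing (R : Type u) [CommRing R] : Prop :=
  ∀ I J : Ideal R, I ≤ J ∨ J ≤ I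

/-- The set of zero-divisors of `R`. -/
def zeroDivisorsSet (R : Type u) [CommRing R] : Set R :=
  {r : R | ∃ s : R, s ≠ 0 ∧ r * s = 0}

/-- An `R`-module `E` is FP-injective if `Ext¹_R(F, E) = 0` for every finitely
presented `R`-module `F`. -/
def IsFPInjective (R : Type u) [CommRing R] (E : Type u) [AddCommGroup E] [Module R E] : Prop :=
  ∀ F : ModuleCat.{u} R, Module.FinitePresentation R F →
    Limits.IsZero (((Ext R (ModuleCat.{u} R) 1).obj (Opposite.op F)).obj (ModuleCat.of R E))

/-- A submodule `D ≤ E` is pure if `0 → D ⊗ N → E ⊗ N` is exact for every module `N`,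
i.e. the sequence `0 → D → E → E/D → 0` remains exact after tensoring with any module. -/
def IsPureSubmodule {R : Type u} [CommRing R] {E : Type u} [AddCommGroup E] [Module R E]
    (D : Submodule R E) : Prop :=
  ∀ (N : Type u) [AddCommGroup N] [Module R N],
    Function.Injective (LinearMap.rTensor N D.subtype)

/-- An `R`-module `G` is almost FP-injective if `G ≅ E/D` for some FP-injective module `E`
and pure submodule `D` of `E`. -/
def IsAlmostFPInjective (R : Type u) [CommRing R] (G : Type u) [AddCommGroup G]
    [Module R G] : Prop :=
  ∃ (E : Type u) (_ : AddCommGroup E) (_ : Module R E) (D : Submodule R E),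
    IsFPInjective R E ∧ IsPureSubmodule D ∧ Nonempty ((E ⧸ D) ≃ₗ[R] G)

/-- The weak dimension of a module, as an element of `ℕ∞`: the least `n` such that
`Tor_{n+1}(M, N) = 0` for all modules `N` (and `⊤ = ∞` if there is no such `n`). -/
noncomputable def weakDim (R : Type u) [CommRing R] (M : Type u) [AddCommGroup M]
    [Module R M] : ℕ∞ :=
  sInf {n : ℕ∞ | ∃ k : ℕ, n = k ∧ ∀ N : ModuleCat.{u} R,
    Limits.IsZero (((Tor (ModuleCat.{u} R) (k + 1)).obj (ModuleCat.of R M)).obj N)}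

/-- The projective dimension of a module, as an element of `ℕ∞`: the least `n` such that
`Ext^{n+1}(M, N) = 0` for all modules `N` (and `⊤ = ∞` if there is no such `n`). -/
noncomputable def projDim (R : Type u) [CommRing R] (M : Type u) [AddCommGroup M]
    [Module R M] : ℕ∞ :=
  sInf {n : ℕ∞ | ∃ k : ℕ, n = k ∧ ∀ N : ModuleCat.{u} R,
    Limits.IsZero (((Ext R (ModuleCat.{u} R) (k + 1)).obj
      (Opposite.op (ModuleCat.of R M))).obj N)}

/-- An IF-ring: every injective module is flat. -/
def IsIFRing (R : Type u) [CommRing R] : Prop :=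
  ∀ (M : Type u) [AddCommGroup M] [Module R M], Module.Injective R M → Module.Flat R M

/-- A semicoherent ring: `Hom_R(E, F)` embeds into a flat module for every pair of
injective modules `E`, `F`. -/
def IsSemicoherent (R : Type u) [CommRing R] : Prop :=
  ∀ (E F : Type u) [AddCommGroup E] [Module R E] [AddCommGroup F] [Module R F],
    Module.Injective R E → Module.Injective R F →
      ∃ (W : Type u) (_ : AddCommGroup W) (_ : Module R W),
        Module.Flat R W ∧ ∃ f : (E →ₗ[R] F) →ₗ[R] W, Function.Injective f

/-- A coherent ring: every finitely generated ideal is finitely presented. -/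
def IsCoherentRing (R : Type u) [CommRing R] : Prop :=
  ∀ I : Ideal R, I.FG → Module.FinitePresentation R I

/-- `i : M →ₗ[R] E` exhibits `E` as an injective hull of `M`: `E` is injective and
`i` is an essential embedding. -/
def IsInjectiveHull (R : Type u) [CommRing R] (M E : Type u) [AddCommGroup M] [Module R M]
    [AddCommGroup E] [Module R E] (i : M →ₗ[R] E) : Prop :=
  Module.Injective R E ∧ Function.Injective i ∧
    ∀ K : Submodule R E, K ≠ ⊥ → K ⊓ LinearMap.range i ≠ ⊥

/-- The bottom prime ideal `M_♯` (as a set): elements killing some nonzero element of `M`. -/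
def bottomSet (R : Type u) [CommRing R] (M : Type u) [AddCommGroup M] [Module R M] : Set R :=
  {s : R | ∃ x : M, x ≠ 0 ∧ s • x = 0}

/-- The top prime ideal `M^♯` (as a set): elements `s` with `sM ⊊ M`. -/
def topSet (R : Type u) [CommRing R] (M : Type u) [AddCommGroup M] [Module R M] : Set R :=
  {s : R | ¬ Function.Surjective fun x : M => s • x}

theorem isZero_ext_one_iff {R : Type u} [CommRing R] {F : ModuleCat.{u} R}
    (P : ProjectiveResolution F) (E : ModuleCat.{u} R) :
    Limits.IsZero (((Ext R (ModuleCat.{u} R) 1).obj (Opposite.op F)).obj E) ↔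
      ∀ f : P.complex.X 1 ⟶ E, P.complex.d 2 1 ≫ f = 0 →
        ∃ h : P.complex.X 0 ⟶ E, P.complex.d 1 0 ≫ h = f := by
  rw [(P.isoExt 1 E).isZero_iff, ← HomologicalComplex.exactAt_iff_isZero_homology,
    HomologicalComplex.exactAt_iff' _ 0 1 2 (by simp) (by simp),
    ShortComplex.moduleCat_exact_iff]
  rfl

theorem isZero_tor_succ_iff {R : Type u} [CommRing R] (G : Type u) [AddCommGroup G] [Module R G]
    {N : ModuleCat.{u} R} (P : ProjectiveResolution N) (k : ℕ) :
    Limits.IsZero (((Tor (ModuleCat.{u} R) (k + 1)).obj (ModuleCat.of R G)).obj N) ↔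
      Function.Exact ((P.complex.d (k + 2) (k + 1)).hom.lTensor G)
        ((P.complex.d (k + 1) k).hom.lTensor G) := by
  rw [Tor_obj, (P.isoLeftDerivedObj _ (k + 1)).isZero_iff, HomologicalComplex.homologyFunctor_obj,
    ← HomologicalComplex.exactAt_iff_isZero_homology,
    HomologicalComplex.exactAt_iff' _ (k + 2) (k + 1) k (by simp) (by simp),
    ShortComplex.ShortExact.moduleCat_exact_iff_function_exact]
  rfl

theorem CategoryTheory.ProjectiveResolution.exact_d {R : Type u} [CommRing R] {N : ModuleCat.{u} R}
    (P : ProjectiveResolution N) (k : ℕ) :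
    Function.Exact (P.complex.d (k + 2) (k + 1)).hom (P.complex.d (k + 1) k).hom :=
  (ShortComplex.ShortExact.moduleCat_exact_iff_function_exact _).1 (P.exact_succ k)

theorem CategoryTheory.ProjectiveResolution.exact_d_π {R : Type u} [CommRing R]
    {N : ModuleCat.{u} R}
    (P : ProjectiveResolution N) :
    Function.Exact (P.complex.d 1 0).hom (P.π.f 0).hom :=
  (ShortComplex.ShortExact.moduleCat_exact_iff_function_exact _).1 P.exact₀

theorem CategoryTheory.ProjectiveResolution.surjective_π {R : Type u} [CommRing R]
    {N : ModuleCat.{u} R}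
    (P : ProjectiveResolution N) :
    Function.Surjective (P.π.f 0).hom :=
  (ModuleCat.epi_iff_surjective _).1 inferInstance

open scoped TensorProduct

/-- Every linear map from the kernel of `π : P → F` to `E` extends to `P`. -/
def ExtendsFromKer {R : Type u} [CommRing R] {P F : Type u} [AddCommGroup P] [Module R P]
    [AddCommGroup F] [Module R F] (π : P →ₗ[R] F) (E : Type u) [AddCommGroup E] [Module R E] :
    Prop :=
  ∀ g : LinearMap.ker π →ₗ[R] E, ∃ h : P →ₗ[R] E, h ∘ₗ (LinearMap.ker π).subtype = g

theorem ExtendsFromKer.of_projective {R : Type u} [CommRing R] {P P' F E : Type u}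
    [AddCommGroup P] [Module R P] [AddCommGroup P'] [Module R P'] [AddCommGroup F] [Module R F]
    [AddCommGroup E] [Module R E] [Module.Projective R P] [Module.Projective R P']
    {π : P →ₗ[R] F} {π' : P' →ₗ[R] F} (hπ : Function.Surjective π)
    (hπ' : Function.Surjective π') (h : ExtendsFromKer π' E) : ExtendsFromKer π E := by
  intro g
  obtain ⟨α, hα⟩ := Module.projective_lifting_property π' π hπ'
  obtain ⟨β, hβ⟩ := Module.projective_lifting_property π π' hπ
  have hα' (x : P) : π' (α x) = π x := LinearMap.congr_fun hα x
  have hβ' (x : P') : π (β x) = π' x := LinearMap.congr_fun hβ x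
  let β₁ : LinearMap.ker π' →ₗ[R] LinearMap.ker π :=
    β.restrict fun x hx ↦ by simpa [hβ'] using hx
  let γ : P →ₗ[R] LinearMap.ker π :=
    (LinearMap.id - β ∘ₗ α).codRestrict _ fun x ↦ by simp [hβ', hα']
  obtain ⟨e, he⟩ := h (g ∘ₗ β₁)
  refine ⟨e ∘ₗ α + g ∘ₗ γ, LinearMap.ext fun x ↦ ?_⟩
  have hx : π' (α x) = 0 := by simp [hα']
  have h₁ : e (α x) = g (β₁ ⟨α x, hx⟩) := LinearMap.congr_fun he ⟨α x, hx⟩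
  have h₂ : β₁ ⟨α x, hx⟩ + γ x = x := by
    ext
    simp [β₁, γ]
  simp only [LinearMap.comp_apply, LinearMap.add_apply, Submodule.subtype_apply, h₁, ← map_add, h₂]

theorem isZero_ext_one_iff_extendsFromKer {R : Type u} [CommRing R] {P F E : Type u}
    [AddCommGroup P] [Module R P] [AddCommGroup F] [Module R F] [AddCommGroup E] [Module R E]
    [Module.Projective R P] {π : P →ₗ[R] F} (hπ : Function.Surjective π) :
    Limits.IsZero (((Ext R (ModuleCat.{u} R) 1).obj (Opposite.op (ModuleCat.of R F))).obj
      (ModuleCat.of R E)) ↔ ExtendsFromKer π E := by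
  let Q := projectiveResolution (ModuleCat.of R F)
  have hQ (k : ℕ) : Module.Projective R (Q.complex.X k) :=
    (IsProjective.iff_projective _).2 (Q.projective k)
  let ε : Q.complex.X 0 →ₗ[R] F := (Q.π.f 0).hom
  have hε : Function.Surjective ε := Q.surjective_π
  have hd : Function.Exact (Q.complex.d 1 0).hom ε := Q.exact_d_π
  have key : ExtendsFromKer ε E ↔ ExtendsFromKer π E :=
    ⟨.of_projective hπ hε, .of_projective hε hπ⟩
  rw [← key, isZero_ext_one_iff Q]
  let δ : Q.complex.X 1 →ₗ[R] LinearMap.ker ε :=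
    (Q.complex.d 1 0).hom.codRestrict _ fun x ↦ hd.apply_apply_eq_zero x
  have hδ : Function.Surjective δ := fun ⟨y, hy⟩ ↦ by
    obtain ⟨x, rfl⟩ := (hd y).1 hy
    exact ⟨x, rfl⟩
  constructor
  · intro H g
    obtain ⟨h, hh⟩ := H (ModuleCat.ofHom (g ∘ₗ δ)) (by
      ext x
      have : δ ((Q.complex.d 2 1).hom x) = 0 := by
        ext
        exact (Q.exact_d 0).apply_apply_eq_zero x
      simp [this])
    refine ⟨h.hom, LinearMap.ext fun y ↦ ?_⟩
    obtain ⟨x, rfl⟩ := hδ y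
    exact congr($(hh).hom x)
  · intro H f hf
    have hker : LinearMap.ker δ ≤ LinearMap.ker f.hom := fun x hx ↦ by
      obtain ⟨y, rfl⟩ := (Q.exact_d 0 x).1 congr(($hx).1)
      exact congr($(hf).hom y)
    obtain ⟨h, hh⟩ := H ((LinearMap.ker δ).liftQ f.hom hker ∘ₗ
      (δ.quotKerEquivOfSurjective hδ).symm.toLinearMap)
    refine ⟨ModuleCat.ofHom h, ?_⟩
    ext x
    have := LinearMap.congr_fun hh (δ x)
    have h₂ : (δ.quotKerEquivOfSurjective hδ).symm (δ x) = Submodule.Quotient.mk x := by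
      rw [LinearEquiv.symm_apply_eq]
      rfl
    simp only [LinearMap.comp_apply, LinearEquiv.coe_coe, h₂] at this
    exact this

theorem exists_lTensor_eq_of_exact {R : Type u} [CommRing R]
    {K F G X₀ X₁ X₂ X₃ : Type u} [AddCommGroup K] [Module R K] [AddCommGroup F] [Module R F]
    [AddCommGroup G] [Module R G] [AddCommGroup X₀] [Module R X₀] [AddCommGroup X₁] [Module R X₁]
    [AddCommGroup X₂] [Module R X₂] [AddCommGroup X₃] [Module R X₃] [Module.Flat R F]
    [Module.Flat R X₁] {i : K →ₗ[R] F} {p : F →ₗ[R] G} (hi : Function.Injective i)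
    (hp : Function.Surjective p) (hip : Function.Exact i p) {d₁ : X₁ →ₗ[R] X₀}
    {d₂ : X₂ →ₗ[R] X₁} {d₃ : X₃ →ₗ[R] X₂} (hd : Function.Exact d₂ d₁)
    (hd' : Function.Exact d₃ d₂) (hG : Function.Exact (d₃.lTensor G) (d₂.lTensor G))
    (z : K ⊗[R] X₁) (hz : d₁.lTensor F (i.rTensor X₁ z) = 0) : ∃ u, d₂.lTensor K u = z := by
  have comm {A B X Y : Type u} [AddCommGroup A] [Module R A] [AddCommGroup B] [Module R B]
      [AddCommGroup X] [Module R X] [AddCommGroup Y] [Module R Y] (f : A →ₗ[R] B) (g : X →ₗ[R] Y)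
      (t : A ⊗[R] X) : g.lTensor B (f.rTensor X t) = f.rTensor Y (g.lTensor A t) := by
    rw [← LinearMap.comp_apply, ← LinearMap.comp_apply, LinearMap.lTensor_comp_rTensor,
      LinearMap.rTensor_comp_lTensor]
  obtain ⟨w, hw⟩ := (Module.Flat.lTensor_exact F hd _).1 hz
  have hpw : d₂.lTensor G (p.rTensor X₂ w) = 0 := by
    rw [comm, hw]
    exact (rTensor_exact X₁ hip hp).apply_apply_eq_zero z
  obtain ⟨v, hv⟩ := (hG _).1 hpw
  obtain ⟨v, rfl⟩ := LinearMap.rTensor_surjective X₃ hp v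
  have h₁ : p.rTensor X₂ (w - d₃.lTensor F v) = 0 := by
    rw [map_sub, ← hv, comm, sub_self]
  obtain ⟨u, hu⟩ := (rTensor_exact X₂ hip hp _).1 h₁
  refine ⟨u, Module.Flat.rTensor_preserves_injective_linearMap (M := X₁) i hi ?_⟩
  rw [← comm, hu, map_sub, hw, (Module.Flat.lTensor_exact F hd').apply_apply_eq_zero, sub_zero]

theorem isPureSubmodule_ker_of_isZero_tor_one {R : Type u} [CommRing R] {F G : Type u}
    [AddCommGroup F] [Module R F] [AddCommGroup G] [Module R G] [Module.Flat R F]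
    {p : F →ₗ[R] G} (hp : Function.Surjective p)
    (hG : ∀ N : ModuleCat.{u} R,
      Limits.IsZero (((Tor (ModuleCat.{u} R) 1).obj (ModuleCat.of R G)).obj N)) :
    IsPureSubmodule (LinearMap.ker p) := by
  intro N _ _
  rw [injective_iff_map_eq_zero]
  intro z hz
  let P := projectiveResolution (ModuleCat.of R N)
  have hP : Module.Projective R (P.complex.X 0) :=
    (IsProjective.iff_projective _).2 (P.projective 0)
  let ε : P.complex.X 0 →ₗ[R] N := (P.π.f 0).hom
  have hd : Function.Exact (P.complex.d 1 0).hom ε := P.exact_d_π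
  obtain ⟨z, rfl⟩ := LinearMap.lTensor_surjective (LinearMap.ker p) (g := ε) P.surjective_π z
  obtain ⟨u, rfl⟩ := exists_lTensor_eq_of_exact (LinearMap.ker p).injective_subtype hp
    (LinearMap.exact_subtype_ker_map p) hd (P.exact_d 0)
    ((isZero_tor_succ_iff G P 0).1 (hG _)) z (by
      rw [← hz, ← LinearMap.comp_apply, ← LinearMap.comp_apply, LinearMap.lTensor_comp_rTensor,
        LinearMap.rTensor_comp_lTensor])
  rw [← LinearMap.comp_apply, ← LinearMap.lTensor_comp, hd.linearMap_comp_eq_zero]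
  simp

theorem isZero_tor_succ_ker {R : Type u} [CommRing R] {F G : Type u}
    [AddCommGroup F] [Module R F] [AddCommGroup G] [Module R G] [Module.Flat R F]
    {p : F →ₗ[R] G} (hp : Function.Surjective p) {N : ModuleCat.{u} R} {k : ℕ}
    (hG : Limits.IsZero (((Tor (ModuleCat.{u} R) (k + 2)).obj (ModuleCat.of R G)).obj N)) :
    Limits.IsZero (((Tor (ModuleCat.{u} R) (k + 1)).obj
      (ModuleCat.of R (LinearMap.ker p))).obj N) := by
  let P := projectiveResolution N
  have hP (k : ℕ) : Module.Projective R (P.complex.X k) :=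
    (IsProjective.iff_projective _).2 (P.projective k)
  rw [isZero_tor_succ_iff _ P] at hG ⊢
  intro z
  constructor
  · intro hz
    refine exists_lTensor_eq_of_exact (LinearMap.ker p).injective_subtype hp
      (LinearMap.exact_subtype_ker_map p) (P.exact_d k) (P.exact_d (k + 1)) hG z ?_
    rw [← LinearMap.comp_apply, LinearMap.lTensor_comp_rTensor,
      ← LinearMap.rTensor_comp_lTensor, LinearMap.comp_apply, hz, map_zero]
  · rintro ⟨u, rfl⟩
    rw [← LinearMap.comp_apply, ← LinearMap.lTensor_comp, (P.exact_d k).linearMap_comp_eq_zero]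
    simp

theorem weakDim_eq_zero_of_flat {R : Type u} [CommRing R] (G : Type u) [AddCommGroup G]
    [Module R G] [Module.Flat R G] : weakDim R G = 0 := by
  refine le_antisymm (sInf_le ⟨0, rfl, fun N ↦ ?_⟩) zero_le
  rw [isZero_tor_succ_iff G (projectiveResolution N)]
  exact Module.Flat.lTensor_exact G ((projectiveResolution N).exact_d 0)

theorem IsChainRing.dvd_total {R : Type u} [CommRing R] (hR : IsChainRing R) (a b : R) :
    a ∣ b ∨ b ∣ a := by
  simpa only [Ideal.span_singleton_le_span_singleton] using (hR (.span {b}) (.span {a}))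

theorem notMem_zeroDivisorsSet {R : Type u} [CommRing R] {t : R} :
    t ∉ zeroDivisorsSet R ↔ ∀ s, t * s = 0 → s = 0 := by
  simp [zeroDivisorsSet, imp.swap]

theorem mul_notMem_zeroDivisorsSet {R : Type u} [CommRing R] {s t : R}
    (hs : s ∉ zeroDivisorsSet R) (ht : t ∉ zeroDivisorsSet R) : s * t ∉ zeroDivisorsSet R := by
  rw [notMem_zeroDivisorsSet] at *
  exact fun x hx ↦ ht x (hs _ (by rw [← mul_assoc, hx]))

theorem mem_zeroDivisorsSet_of_dvd {R : Type u} [CommRing R] {s t : R}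
    (hs : s ∈ zeroDivisorsSet R) (h : s ∣ t) : t ∈ zeroDivisorsSet R := by
  obtain ⟨⟨q, hq, hsq⟩, ⟨c, rfl⟩⟩ := hs, h
  exact ⟨q, hq, by rw [mul_right_comm, hsq, zero_mul]⟩

theorem IsChainRing.dvd_of_mem_of_notMem {R : Type u} [CommRing R] (hR : IsChainRing R) {s t : R}
    (hs : s ∈ zeroDivisorsSet R) (ht : t ∉ zeroDivisorsSet R) : t ∣ s :=
  (hR.dvd_total t s).resolve_right fun h ↦ ht (mem_zeroDivisorsSet_of_dvd hs h)

theorem IsChainRing.exists_forall_dvd {R : Type u} [CommRing R] (hR : IsChainRing R)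
    {ι : Type*} [Finite ι] [Nonempty ι] (f : ι → R) : ∃ i, ∀ j, f i ∣ f j := by
  have hdir : Directed (fun x y : R ↦ y ∣ x) f := fun i j ↦ by
    rcases hR.dvd_total (f i) (f j) with h | h
    · exact ⟨i, dvd_rfl, h⟩
    · exact ⟨j, h, dvd_rfl⟩
  have : IsTrans R (fun x y : R ↦ y ∣ x) := ⟨fun _ _ _ h₁ h₂ ↦ h₂.trans h₁⟩
  exact hdir.finite_le id

theorem IsChainRing.exists_mul_eq_zero_of_flat {R : Type u} [CommRing R] (hR : IsChainRing R)
    {M : Type*} [AddCommGroup M] [Module R M] [Module.Flat R M] {a : R} {x : M}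
    (h : a • x = 0) : ∃ r : R, a * r = 0 ∧ ∃ y : M, x = r • y := by
  obtain ⟨κ, b, y, hx, hb⟩ := Module.Flat.isTrivialRelation_of_sum_smul_eq_zero
    (ι := Unit) (f := fun _ ↦ a) (x := fun _ ↦ x) (by simpa using h)
  simp only [Finset.univ_unique, Finset.sum_singleton] at hb
  rcases isEmpty_or_nonempty (Fin κ) with hκ | hκ
  · exact ⟨0, mul_zero _, 0, by simpa using hx ()⟩
  obtain ⟨i, hi⟩ := hR.exists_forall_dvd (b ())
  choose c hc using hi
  refine ⟨b () i, hb i, ∑ j, c j • y j, ?_⟩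
  refine (hx ()).trans ?_
  rw [Finset.smul_sum]
  exact Finset.sum_congr rfl fun j _ ↦ by rw [smul_smul, ← hc]

theorem IsChainRing.exists_span_singleton_of_fg {R : Type u} [CommRing R] (hR : IsChainRing R)
    {I : Ideal R} (hI : I.FG) : ∃ a, I = Ideal.span {a} := by
  obtain ⟨S, rfl⟩ := hI
  rcases S.eq_empty_or_nonempty with rfl | hS
  · exact ⟨0, by simp⟩
  have : Nonempty S := hS.to_subtype
  obtain ⟨i, hi⟩ := hR.exists_forall_dvd (fun s : S ↦ (s : R))
  refine ⟨i, le_antisymm (Submodule.span_le.2 fun s hs ↦ ?_) (Ideal.span_mono (by simp))⟩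
  exact Ideal.mem_span_singleton.2 (hi ⟨s, hs⟩)

theorem IsChainRing.flat_of_forall_smul_eq_zero {R : Type u} [CommRing R] (hR : IsChainRing R)
    {M : Type u} [AddCommGroup M] [Module R M]
    (h : ∀ (a : R) (x : M), a • x = 0 → ∃ r : R, a * r = 0 ∧ ∃ y : M, x = r • y) :
    Module.Flat R M := by
  rw [Module.Flat.iff_rTensor_injective]
  intro I hI
  obtain ⟨a, rfl⟩ := hR.exists_span_singleton_of_fg hI
  let α : Ideal.span {a} := ⟨a, Ideal.mem_span_singleton_self a⟩
  have hα (z : Ideal.span {a} ⊗[R] M) : ∃ x, z = α ⊗ₜ[R] x := by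
    induction z with
    | zero => exact ⟨0, by simp⟩
    | tmul b x =>
      obtain ⟨c, hc⟩ := Ideal.mem_span_singleton'.1 b.2
      obtain rfl : b = c • α := Subtype.ext hc.symm
      exact ⟨c • x, by rw [TensorProduct.smul_tmul]⟩
    | add z₁ z₂ h₁ h₂ =>
      obtain ⟨⟨x₁, rfl⟩, ⟨x₂, rfl⟩⟩ := h₁, h₂
      exact ⟨x₁ + x₂, by rw [TensorProduct.tmul_add]⟩
  rw [injective_iff_map_eq_zero]
  intro z hz
  obtain ⟨x, rfl⟩ := hα z
  have hx : a • x = 0 := by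
    simpa [α] using congr(TensorProduct.lid R M $hz)
  obtain ⟨r, hr, y, rfl⟩ := h a x hx
  have : r • α = 0 := Subtype.ext (by simpa [α, mul_comm] using hr)
  rw [← TensorProduct.smul_tmul, this, TensorProduct.zero_tmul]

theorem IsChainRing.exists_mul_mul_eq_zero {R : Type u} [CommRing R] (hR : IsChainRing R)
    {s t : R} (hs : s ≠ 0) (ht : t ∈ zeroDivisorsSet R) : ∃ q, s * t * q = 0 ∧ s * q ≠ 0 := by
  by_cases hst : s * t = 0
  · exact ⟨1, by simpa using hst, by simpa using hs⟩
  obtain ⟨q, hq, htq⟩ := ht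
  rcases hR.dvd_total s q with ⟨v, rfl⟩ | ⟨v, rfl⟩
  · exact ⟨v, by linear_combination htq, hq⟩
  · exact absurd (by linear_combination v * htq) hst

theorem exists_injective_embedding (R : Type u) [CommRing R] (M : Type u) [AddCommGroup M]
    [Module R M] : ∃ (E : Type u) (_ : AddCommGroup E) (_ : Module R E),
      Module.Injective R E ∧ ∃ i : M →ₗ[R] E, Function.Injective i :=
  ⟨(Injective.under (ModuleCat.of R M) : ModuleCat.{u} R), inferInstance, inferInstance,
    Module.injective_module_of_injective_object R _ (inj := Injective.injective_under _),
    (Injective.ι (ModuleCat.of R M)).hom, (ModuleCat.mono_iff_injective _).1 inferInstance⟩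

theorem IsSemicoherent.exists_annihilator_mul_annihilator {R : Type u} [CommRing R]
    (hR : IsChainRing R) (hsc : IsSemicoherent R) (a : R) :
    ∃ r, a * r = 0 ∧ ∀ s c, a * s = 0 → r * c = 0 → c * s = 0 := by
  obtain ⟨E, _, _, hE, i, hi⟩ := exists_injective_embedding R R
  obtain ⟨F, _, _, hF, j, hj⟩ :=
    exists_injective_embedding R (E ⧸ LinearMap.range (LinearMap.lsmul R E a))
  obtain ⟨W, _, _, hW, φ, hφ⟩ := hsc E F hE hF
  let f : E →ₗ[R] F := j ∘ₗ Submodule.mkQ _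
  have hf (c : R) (x : E) : c • f x = 0 ↔ ∃ e, a • e = c • x := by
    simp only [f, LinearMap.comp_apply, ← map_smul]
    rw [map_eq_zero_iff j hj, Submodule.mkQ_apply, Submodule.Quotient.mk_eq_zero]
    simp
  have haf : a • f = 0 := LinearMap.ext fun x ↦ (hf a x).2 ⟨x, rfl⟩
  obtain ⟨r, har, w, hw⟩ := hR.exists_mul_eq_zero_of_flat (a := a) (x := φ f)
    (by rw [← map_smul, haf, map_zero])
  refine ⟨r, har, fun s c has hrc ↦ ?_⟩
  have hcf : c • f = 0 := hφ (by rw [map_smul, hw, smul_smul, mul_comm, hrc, zero_smul, map_zero])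
  obtain ⟨e, he⟩ := (hf c (i 1)).1 (LinearMap.congr_fun hcf _)
  apply hi
  have : c * s = s • c • 1 := by simp [mul_comm]
  rw [this, map_smul, map_smul, ← he, smul_smul, mul_comm, has, zero_smul, map_zero]

/-- In a semicoherent chain ring with total ring of quotients `Q`, the annihilators in `Q` of `a`
and of a suitable `r` are `rQ` and `aQ`. -/
theorem IsSemicoherent.exists_mutual_annihilator {R : Type u} [CommRing R]
    (hR : IsChainRing R) (hsc : IsSemicoherent R) (a : R) :
    ∃ r, a * r = 0 ∧ (∀ s, a * s = 0 → ∃ t ∉ zeroDivisorsSet R, r ∣ t * s) ∧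
      ∀ c, r * c = 0 → ∃ t ∉ zeroDivisorsSet R, a ∣ t * c := by
  obtain ⟨r, har, h⟩ := hsc.exists_annihilator_mul_annihilator hR a
  have aux (x s : R) (hx : ∀ c, x * c = 0 → s * c = 0) :
      ∃ t ∉ zeroDivisorsSet R, x ∣ t * s := by
    by_cases hs : s = 0
    · refine ⟨1, notMem_zeroDivisorsSet.2 (by simp), by simp [hs]⟩
    rcases hR.dvd_total x s with hxs | ⟨t, rfl⟩
    · exact ⟨1, notMem_zeroDivisorsSet.2 (by simp), by simpa using hxs⟩
    by_cases ht : t ∈ zeroDivisorsSet R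
    · obtain ⟨q, hq, hq'⟩ := hR.exists_mul_mul_eq_zero hs ht
      exact absurd (hx q hq) hq'
    · exact ⟨t, ht, by rw [mul_comm]⟩
  exact ⟨r, har, fun s hs ↦ aux r s fun c hc ↦ by rw [mul_comm]; exact h s c hs hc,
    fun c hc ↦ aux a c fun s hs ↦ h s c hs hc⟩

/-- Flatness of the localization of `M` at the multiplicative set of nonzerodivisors, in terms of
elements (over a chain ring). -/
def IsGenericallyFlat (R : Type u) [CommRing R] (M : Type u) [AddCommGroup M] [Module R M] :
    Prop :=
  ∀ (a : R) (x : M), a • x = 0 →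
    ∃ s ∉ zeroDivisorsSet R, ∃ r : R, a * r = 0 ∧ ∃ y : M, s • x = r • y

theorem IsChainRing.isGenericallyFlat_of_flat {R : Type u} [CommRing R] (hR : IsChainRing R)
    (M : Type u) [AddCommGroup M] [Module R M] [Module.Flat R M] : IsGenericallyFlat R M := by
  intro a x hx
  obtain ⟨r, hr, y, hy⟩ := hR.exists_mul_eq_zero_of_flat hx
  exact ⟨1, notMem_zeroDivisorsSet.2 (by simp), r, hr, y, by simpa using hy⟩

theorem IsGenericallyFlat.of_ker {R : Type u} [CommRing R] (hR : IsChainRing R)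
    (hsc : IsSemicoherent R) {F G : Type u} [AddCommGroup F] [Module R F] [AddCommGroup G]
    [Module R G] {p : F →ₗ[R] G} (hp : Function.Surjective p) (hF : IsGenericallyFlat R F)
    (hK : IsGenericallyFlat R (LinearMap.ker p)) : IsGenericallyFlat R G := by
  intro a x hx
  obtain ⟨x, rfl⟩ := hp x
  obtain ⟨b, hab, -, hb⟩ := hsc.exists_mutual_annihilator hR a
  have hax : a • x ∈ LinearMap.ker p := by simpa using hx
  obtain ⟨s, hs, r, hbr, k, hk⟩ := hK b ⟨a • x, hax⟩
    (Subtype.ext (by simp [smul_smul, mul_comm b, hab]))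
  replace hk : s • a • x = r • (k : F) := congr(($hk).1)
  obtain ⟨t, ht, u, hu⟩ := hb r hbr
  obtain ⟨v, hv, r', har', f, hf⟩ := hF a ((t * s) • x - u • (k : F)) (by
    rw [smul_sub, smul_smul a u, ← hu, mul_smul t r, ← hk]
    module)
  refine ⟨v * (t * s), mul_notMem_zeroDivisorsSet hv (mul_notMem_zeroDivisorsSet ht hs), r', har',
    p f, ?_⟩
  have hk0 : p k = 0 := k.2
  rw [← map_smul, ← map_smul, ← hf, map_smul, map_smul, map_sub, map_smul, map_smul, hk0,
    smul_zero, sub_zero, mul_smul]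

theorem IsPureSubmodule.exists_smul_eq {R : Type u} [CommRing R] {E : Type u} [AddCommGroup E]
    [Module R E] {D : Submodule R E} (hD : IsPureSubmodule D) {a : R} {e : E} (h : a • e ∈ D) :
    ∃ d ∈ D, a • d = a • e := by
  let N := R ⧸ Ideal.span {a}
  have h₁ : (⟨a • e, h⟩ : D) ⊗ₜ[R] (1 : N) = 0 := by
    refine hD N ?_
    have : a • (1 : N) = 0 := by
      rw [Algebra.smul_def, mul_one]
      exact Ideal.Quotient.eq_zero_iff_mem.2 (Ideal.mem_span_singleton_self a)
    rw [LinearMap.rTensor_tmul, Submodule.subtype_apply, TensorProduct.smul_tmul, this, map_zero,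
      TensorProduct.tmul_zero]
  have h₂ : (Submodule.Quotient.mk (⟨a • e, h⟩ : D) :
      D ⧸ (Ideal.span {a} • (⊤ : Submodule R D))) = 0 := by
    rw [← TensorProduct.quotTensorEquivQuotSMul_mk_one_tmul, ← TensorProduct.comm_tmul, h₁,
      map_zero, map_zero]
  rw [Submodule.Quotient.mk_eq_zero, Submodule.ideal_span_singleton_smul,
    Submodule.mem_smul_pointwise_iff_exists] at h₂
  obtain ⟨d, -, hd⟩ := h₂
  exact ⟨d, d.2, congr(($hd).1)⟩

theorem IsPureSubmodule.exists_lift_of_smul_eq_zero {R : Type u} [CommRing R] {E G : Type u}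
    [AddCommGroup E] [Module R E] [AddCommGroup G] [Module R G] {q : E →ₗ[R] G}
    (hq : Function.Surjective q) (hD : IsPureSubmodule (LinearMap.ker q)) {a : R} {x : G}
    (h : a • x = 0) : ∃ e, q e = x ∧ a • e = 0 := by
  obtain ⟨e, rfl⟩ := hq x
  obtain ⟨d, hd, hde⟩ := hD.exists_smul_eq (a := a) (e := e) (by simpa using h)
  exact ⟨e - d, by simpa using hd, by rw [smul_sub, hde, sub_self]⟩

theorem isGenericallyFlat_of_isZero_tor {R : Type u} [CommRing R] (hR : IsChainRing R)
    (hsc : IsSemicoherent R) (k : ℕ) (G : Type u) [AddCommGroup G] [Module R G]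
    (hG : ∀ N : ModuleCat.{u} R,
      Limits.IsZero (((Tor (ModuleCat.{u} R) (k + 1)).obj (ModuleCat.of R G)).obj N)) :
    IsGenericallyFlat R G := by
  have hp : Function.Surjective (Finsupp.linearCombination R (id : G → G)) :=
    Finsupp.linearCombination_id_surjective R G
  have hF := hR.isGenericallyFlat_of_flat (G →₀ R)
  induction k generalizing G with
  | zero =>
    intro a x hx
    obtain ⟨f, rfl, hf⟩ :=
      (isPureSubmodule_ker_of_isZero_tor_one hp hG).exists_lift_of_smul_eq_zero hp hx
    obtain ⟨s, hs, r, hr, y, hy⟩ := hF a f hf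
    exact ⟨s, hs, r, hr, _, by rw [← map_smul, hy, map_smul]⟩
  | succ k ih =>
    exact .of_ker hR hsc hp hF (ih _ (fun N ↦ isZero_tor_succ_ker hp (hG N))
      (Finsupp.linearCombination_id_surjective R _) (hR.isGenericallyFlat_of_flat _))

theorem weakDim_eq_top_of_not_isGenericallyFlat {R : Type u} [CommRing R] (hR : IsChainRing R)
    (hsc : IsSemicoherent R) {G : Type u} [AddCommGroup G] [Module R G]
    (hG : ¬ IsGenericallyFlat R G) : weakDim R G = ⊤ := by
  rw [weakDim, sInf_eq_top]
  rintro _ ⟨k, rfl, hk⟩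
  exact absurd (isGenericallyFlat_of_isZero_tor hR hsc k G hk) hG

theorem IsChainRing.exists_extension_of_fg {R : Type u} [CommRing R] (hR : IsChainRing R)
    {E : Type u} [AddCommGroup E] [Module R E]
    (hE : ∀ (a : R) (x : E), (∀ c, a * c = 0 → c • x = 0) → ∃ y, a • y = x)
    {ι : Type} [Fintype ι] (s : Finset ι) (K : Submodule R (ι → R)) (hK : K.FG)
    (hKs : ∀ k ∈ K, ∀ i ∉ s, k i = 0) (g : K →ₗ[R] E) :
    ∃ h : (ι → R) →ₗ[R] E, h ∘ₗ K.subtype = g := by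
  classical
  induction s using Finset.strongInduction generalizing K with
  | H s ih =>
  by_cases hbot : K = ⊥
  · subst hbot
    exact ⟨0, Subsingleton.elim _ _⟩
  obtain ⟨k, hk, i, hki, hdvd⟩ : ∃ k ∈ K, ∃ i, k i ≠ 0 ∧ ∀ y ∈ K, ∀ j, k i ∣ y j := by
    obtain ⟨S, rfl⟩ := hK
    have hne : ∃ k ∈ S, ∃ i, k i ≠ 0 := by
      by_contra! hcon
      exact hbot (Submodule.span_eq_bot.2 fun k hk ↦ funext (hcon k hk))
    obtain ⟨k₀, hk₀, i₀, hki₀⟩ := hne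
    have : Nonempty (S × ι) := ⟨(⟨k₀, hk₀⟩, i₀)⟩
    obtain ⟨⟨k, i⟩, hki⟩ := hR.exists_forall_dvd fun x : S × ι ↦ (x.1 : ι → R) x.2
    refine ⟨k, Submodule.subset_span k.2, i, fun h0 ↦ hki₀ ?_, fun y hy j ↦ ?_⟩
    · exact zero_dvd_iff.1 (h0 ▸ hki (⟨k₀, hk₀⟩, i₀))
    · induction hy using Submodule.span_induction with
      | mem y hy => exact hki (⟨y, hy⟩, j)
      | zero => exact dvd_zero _
      | add y z _ _ hy hz => exact dvd_add hy hz
      | smul a y _ hy => exact dvd_mul_of_dvd_right hy a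
  have his : i ∈ s := by_contra fun h ↦ hki (hKs k hk i h)
  have hv (j : ι) : ∃ w, k j = k i * w ∧ (j ∉ s → w = 0) ∧ (j = i → w = 1) := by
    by_cases hji : j = i
    · subst hji
      exact ⟨1, by simp, by simp [his], by simp⟩
    by_cases hjs : j ∈ s
    · obtain ⟨w, hw⟩ := hdvd k hk j
      exact ⟨w, hw, by simp [hjs], by simp [hji]⟩
    · exact ⟨0, by simp [hKs k hk j hjs], by simp, by simp [hji]⟩
  choose v hv hvs hvi using hv
  have hkv : k = k i • v := funext hv
  obtain ⟨e, he⟩ := hE (k i) (g ⟨k, hk⟩) fun c hc ↦ by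
    rw [← map_smul, show c • (⟨k, hk⟩ : K) = 0 from Subtype.ext ?_, map_zero]
    change c • k = 0
    rw [hkv, smul_smul, mul_comm, hc, zero_smul]
  let T : (ι → R) →ₗ[R] (ι → R) :=
    LinearMap.id - (LinearMap.proj i).smulRight v
  have hT (y : ι → R) : T y = y - y i • v := rfl
  have hmem {y : ι → R} (hy : y ∈ K) : ∃ d, y i • v = d • k ∧ y i = d * k i := by
    obtain ⟨d, hd⟩ := hdvd y hy i
    refine ⟨d, ?_, by rw [hd, mul_comm]⟩
    conv_rhs => rw [hkv]
    rw [hd, smul_smul, mul_comm]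
  have hTK : K.map T ≤ K := by
    rintro _ ⟨y, hy, rfl⟩
    obtain ⟨d, hd, -⟩ := hmem hy
    rw [hT, hd]
    exact K.sub_mem hy (K.smul_mem d hk)
  obtain ⟨h, hh⟩ := ih (s.erase i) (Finset.erase_ssubset his) (K.map T) (hK.map T) (by
    rintro _ ⟨y, hy, rfl⟩ j hj
    rw [hT, Pi.sub_apply, Pi.smul_apply, smul_eq_mul]
    by_cases hji : j = i
    · subst hji
      simp [hvi]
    · have hjs : j ∉ s := by simpa [hji] using hj
      simp [hvs j hjs, hKs y hy j hjs]) (g ∘ₗ Submodule.inclusion hTK)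
  refine ⟨h ∘ₗ T + (LinearMap.proj i).smulRight e, LinearMap.ext fun y ↦ ?_⟩
  obtain ⟨d, hd, hd'⟩ := hmem y.2
  have h₁ : h (T y) = g ⟨T y, hTK ⟨y, y.2, rfl⟩⟩ :=
    LinearMap.congr_fun hh ⟨T y, y, y.2, rfl⟩
  have h₂ : (y : ι → R) i • e = g (d • ⟨k, hk⟩) := by
    rw [hd', mul_smul, he, map_smul]
  change h (T y) + (y : ι → R) i • e = g y
  rw [h₁, h₂, ← map_add]
  congr 1
  ext1
  simp [hT, hd]

theorem IsChainRing.isFPInjective_of_forall_exists_smul_eq {R : Type u} [CommRing R]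
    (hR : IsChainRing R) {E : Type u} [AddCommGroup E] [Module R E]
    (hE : ∀ (a : R) (x : E), (∀ c, a * c = 0 → c • x = 0) → ∃ y, a • y = x) :
    IsFPInjective R E := by
  intro F hF
  obtain ⟨n, π, hπ⟩ := Module.Finite.exists_fin' R F
  refine (isZero_ext_one_iff_extendsFromKer hπ).2 fun g ↦ ?_
  exact hR.exists_extension_of_fg hE Finset.univ _
    (Module.FinitePresentation.fg_ker π hπ) (by simp) g

theorem IsFPInjective.exists_smul_eq {R : Type u} [CommRing R] {E : Type u} [AddCommGroup E]
    [Module R E] (hE : IsFPInjective R E) {a : R} {x : E} (hx : ∀ c, a * c = 0 → c • x = 0) :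
    ∃ y, a • y = x := by
  let π : R →ₗ[R] R ⧸ Ideal.span {a} := Submodule.mkQ _
  have hπ : Function.Surjective π := Submodule.mkQ_surjective _
  have hker : LinearMap.ker π = LinearMap.range (LinearMap.toSpanSingleton R R a) := by
    rw [Submodule.ker_mkQ, LinearMap.range_toSpanSingleton]
  have hfp : Module.FinitePresentation R (R ⧸ Ideal.span {a}) :=
    Module.finitePresentation_of_surjective π hπ
      (by rw [Submodule.ker_mkQ]; exact ⟨{a}, by simp⟩)
  have hext := (isZero_ext_one_iff_extendsFromKer hπ).1
    (hE (ModuleCat.of R (R ⧸ Ideal.span {a})) hfp)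
  let α : R →ₗ[R] LinearMap.ker π :=
    (LinearMap.toSpanSingleton R R a).codRestrict _ fun c ↦ hker ▸ ⟨c, rfl⟩
  have hα : Function.Surjective α := fun ⟨y, hy⟩ ↦ by
    obtain ⟨c, rfl⟩ := hker ▸ hy
    exact ⟨c, rfl⟩
  have hle : LinearMap.ker α ≤ LinearMap.ker (LinearMap.toSpanSingleton R E x) := fun c hc ↦
    hx c (by rw [mul_comm]; exact congr(($hc).1))
  obtain ⟨h, hh⟩ := hext ((LinearMap.ker α).liftQ _ hle ∘ₗ
    (α.quotKerEquivOfSurjective hα).symm.toLinearMap)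
  have h₂ : (α.quotKerEquivOfSurjective hα).symm (α 1) = Submodule.Quotient.mk 1 := by
    rw [LinearEquiv.symm_apply_eq]
    rfl
  have h₁ := LinearMap.congr_fun hh (α 1)
  simp only [LinearMap.comp_apply, LinearEquiv.coe_coe, h₂] at h₁
  refine ⟨h 1, ?_⟩
  rw [← map_smul]
  calc h (a • 1) = h (α 1) := by simp [α]
    _ = (1 : R) • x := h₁
    _ = x := one_smul R x

theorem IsChainRing.exists_ne_zero_mem_zeroDivisorsSet {R : Type u} [CommRing R]
    (hR : IsChainRing R) (hnc : ¬ IsCoherentRing R) : ∃ r ∈ zeroDivisorsSet R, r ≠ 0 := by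
  by_contra! hcon
  have hdom : NoZeroDivisors R := ⟨fun {a b} hab ↦ by
    by_contra! h
    exact h.1 (hcon a ⟨b, h.2, hab⟩)⟩
  refine hnc fun I hI ↦ ?_
  obtain ⟨a, rfl⟩ := hR.exists_span_singleton_of_fg hI
  by_cases ha : a = 0
  · have : Subsingleton (Ideal.span {a}) := by
      rw [ha, Ideal.span_singleton_eq_bot.2 rfl]
      infer_instance
    infer_instance
  · have : Nontrivial R := ⟨a, 0, ha⟩
    have : IsDomain R := NoZeroDivisors.to_isDomain R
    exact Module.FinitePresentation.of_equiv (LinearEquiv.toSpanNonzeroSingleton R R a ha)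

theorem not_isGenericallyFlat_of_smul_eq_zero {R : Type u} [CommRing R] (hR : IsChainRing R)
    {E G : Type u} [AddCommGroup E] [Module R E] [AddCommGroup G] [Module R G]
    (hE : IsFPInjective R E) {q : E →ₗ[R] G} (hq : Function.Surjective q)
    (hD : IsPureSubmodule (LinearMap.ker q)) {r t : R} (hr : r ∈ zeroDivisorsSet R) (hr0 : r ≠ 0)
    (ht : t ∉ zeroDivisorsSet R) {x : G} (hx : x ≠ 0) (htx : t • x = 0) :
    ¬ IsGenericallyFlat R G := by
  intro hG
  obtain ⟨e, rfl, hte⟩ := hD.exists_lift_of_smul_eq_zero hq htx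
  obtain ⟨y, rfl⟩ := hE.exists_smul_eq (a := r) (x := e) fun c hc ↦ by
    obtain ⟨d, rfl⟩ := hR.dvd_of_mem_of_notMem ⟨r, hr0, by rw [mul_comm, hc]⟩ ht
    rw [mul_comm, mul_smul, hte, smul_zero]
  obtain ⟨s, hs, r', hr', g, hg⟩ := hG (t * r) (q y) (by rwa [mul_smul, ← map_smul])
  rw [mul_assoc] at hr'
  obtain ⟨w, rfl⟩ := hR.dvd_of_mem_of_notMem hr hs
  have hw : w * r' = 0 := notMem_zeroDivisorsSet.1 hs _ (by
    rw [← mul_assoc, notMem_zeroDivisorsSet.1 ht _ hr'])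
  exact hx (by rw [map_smul, mul_comm, mul_smul, hg, smul_smul, hw, zero_smul])

theorem flat_of_zeroDivisor_injective {R : Type u} [CommRing R] (hR : IsChainRing R)
    (hsc : IsSemicoherent R) {E G : Type u} [AddCommGroup E] [Module R E] [AddCommGroup G]
    [Module R G] (hE : IsFPInjective R E) {q : E →ₗ[R] G} (hq : Function.Surjective q)
    (hD : IsPureSubmodule (LinearMap.ker q)) {s : R} (hs : s ∈ zeroDivisorsSet R)
    (hinj : ∀ x : G, s • x = 0 → x = 0) : Module.Flat R G := by
  refine hR.flat_of_forall_smul_eq_zero fun a x hax ↦ ?_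
  rcases hR.dvd_total a s with ⟨d, rfl⟩ | ⟨b, rfl⟩
  · exact ⟨0, mul_zero _, 0, by rw [smul_zero, hinj x (by rw [mul_comm, mul_smul, hax, smul_zero])]⟩
  obtain ⟨e, rfl, hbe⟩ := hD.exists_lift_of_smul_eq_zero hq (hinj (b • x) (by rwa [smul_smul]))
  obtain ⟨r, har, -, hr⟩ := hsc.exists_mutual_annihilator hR (s * b)
  obtain ⟨y, rfl⟩ := hE.exists_smul_eq (a := r) (x := e) fun c hc ↦ by
    obtain ⟨t, ht, d, hd⟩ := hr c hc
    obtain ⟨s, rfl⟩ := hR.dvd_of_mem_of_notMem hs ht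
    have : c - s * b * d = 0 := notMem_zeroDivisorsSet.1 ht _ (by linear_combination hd)
    rw [sub_eq_zero.1 this, mul_right_comm, mul_smul, hbe, smul_zero]
  exact ⟨r, har, q y, map_smul _ _ _⟩

/-- Let `R` be a chain ring which is semicoherent but not coherent,
with ideal of zero-divisors `Z`, and `G` a nonzero almost FP-injective module. Then:
(a) `w.d.(G) = ∞` if `Z ⊊ G_♯`; (b) `w.d.(G) = 0` if `G_♯ ∪ G^♯ ⊊ Z`;
(c) if `G_♯ ∪ G^♯ = Z` then `w.d.(G) = 0` when `G` is FP-injective and `w.d.(G) = ∞`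
when it is not. -/
theorem weakDim_of_almostFPInjective_semicoherent_not_coherent (R : Type u) [CommRing R]
    (hR : IsChainRing R) (hsc : IsSemicoherent R) (hnc : ¬ IsCoherentRing R)
    (G : Type u) [AddCommGroup G] [Module R G] [Nontrivial G]
    (hG : IsAlmostFPInjective R G) :
    (zeroDivisorsSet R ⊂ bottomSet R G → weakDim R G = ⊤) ∧
    (bottomSet R G ∪ topSet R G ⊂ zeroDivisorsSet R → weakDim R G = 0) ∧
    (bottomSet R G ∪ topSet R G = zeroDivisorsSet R →
      (IsFPInjective R G → weakDim R G = 0) ∧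
      (¬ IsFPInjective R G → weakDim R G = ⊤)) := by
  obtain ⟨E, _, _, D, hE, hD, ⟨φ⟩⟩ := hG
  let q : E →ₗ[R] G := φ.toLinearMap ∘ₗ D.mkQ
  have hq : Function.Surjective q := φ.surjective.comp D.mkQ_surjective
  have hqD : LinearMap.ker q = D := by
    rw [LinearEquiv.ker_comp, Submodule.ker_mkQ]
  rw [← hqD] at hD
  refine ⟨fun h ↦ ?_, fun h ↦ ?_, fun h ↦ ?_⟩
  · obtain ⟨r, hr, hr0⟩ := hR.exists_ne_zero_mem_zeroDivisorsSet hnc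
    obtain ⟨t, ⟨x, hx, htx⟩, ht⟩ := Set.exists_of_ssubset h
    exact weakDim_eq_top_of_not_isGenericallyFlat hR hsc
      (not_isGenericallyFlat_of_smul_eq_zero hR hE hq hD hr hr0 ht hx htx)
  · obtain ⟨s, hs, hs'⟩ := Set.exists_of_ssubset h
    have := flat_of_zeroDivisor_injective hR hsc hE hq hD hs fun x hx ↦
      by_contra fun hx0 ↦ hs' (Or.inl ⟨x, hx0, hx⟩)
    exact weakDim_eq_zero_of_flat G
  · have hinj {t : R} (ht : t ∉ zeroDivisorsSet R) {x : G} (hx : t • x = 0) : x = 0 :=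
      by_contra fun hx0 ↦ ht (h ▸ Or.inl ⟨x, hx0, hx⟩)
    have hsurj {t : R} (ht : t ∉ zeroDivisorsSet R) : Function.Surjective fun x : G ↦ t • x :=
      by_contra fun hx ↦ ht (h ▸ Or.inr hx)
    refine ⟨fun hFP ↦ ?_, fun hFP ↦ ?_⟩
    · have : Module.Flat R G := hR.flat_of_forall_smul_eq_zero fun a x hax ↦ by
        obtain ⟨r, har, -, hr⟩ := hsc.exists_mutual_annihilator hR a
        obtain ⟨y, hy⟩ := hFP.exists_smul_eq (a := r) (x := x) fun c hc ↦ by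
          obtain ⟨t, ht, d, hd⟩ := hr c hc
          exact hinj ht (by rw [smul_smul, hd, mul_comm, mul_smul, hax, smul_zero])
        exact ⟨r, har, y, hy.symm⟩
      exact weakDim_eq_zero_of_flat G
    · refine weakDim_eq_top_of_not_isGenericallyFlat hR hsc fun hG ↦
        hFP (hR.isFPInjective_of_forall_exists_smul_eq fun a x hx ↦ ?_)
      obtain ⟨r, har, -, hr⟩ := hsc.exists_mutual_annihilator hR a
      obtain ⟨s, hs, r', hr', g, hg⟩ := hG r x (hx r har)
      obtain ⟨t, ht, u, hu⟩ := hr r' hr'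
      have hts := mul_notMem_zeroDivisorsSet ht hs
      obtain ⟨y, hy⟩ := hsurj hts (u • g)
      refine ⟨y, sub_eq_zero.1 (hinj hts ?_)⟩
      replace hy : (t * s) • y = u • g := hy
      rw [smul_sub, smul_comm, hy, mul_smul t s x, hg, smul_smul, smul_smul, hu, sub_self]
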